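/- Let p ≥ k ≥ 1, let U ∈ ℂ^{p×k}, let Σ be a k×k Hermitian positive definite complex matrix, let α, β ∈ ℝ, and let ξ_U, η_U, ν_U ∈ ℂ^{p×k} and ξ_Σ, η_Σ, ν_Σ ∈ ℂ^{k×k} with ξ_Σ, η_Σ, ν_Σ Hermitian. Then the function t ↦ Re tr(ξ_U^H (I_p − (1/2)(U + tν_U)(U + tν_U)^H) η_U) + α Re tr((Σ + tν_Σ)^{-1} ξ_Σ (Σ + tν_Σ)^{-1} η_Σ) + β Re tr((Σ + tν_Σ)^{-1} ξ_Σ) · Re tr((Σ + tν_Σ)^{-1} η_Σ), defined for t in a neighborhood of 0, is differentiable at t = 0 with derivative − Re tr(ξ_U^H herm(ν_U U^H) η_U) − 2α Re tr(Σ^{-1} ξ_Σ Σ^{-1} η_Σ Σ^{-1} ν_Σ) − β [Re tr(Σ^{-1} ξ_Σ Σ^{-1} ν_Σ) · Re tr(Σ^{-1} η_Σ) + Re tr(Σ^{-1} ξ_Σ) · Re tr(Σ^{-1} η_Σ Σ^{-1} ν_Σ)]. -/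

import Mathlib

open Matrix
open scoped ComplexOrder

/-- The Hermitian part of a square complex matrix. -/
noncomputable def hermPart {m : Type*} [Fintype m] (A : Matrix m m ℂ) : Matrix m m ℂ :=
  (1/2 : ℂ) • (A + Aᴴ)


section helpers

attribute [local instance] Matrix.linftyOpNormedRing Matrix.linftyOpNormedAlgebra

theorem aux_inv {k : ℕ} (S N : Matrix (Fin k) (Fin k) ℂ) (hS : IsUnit S) :
    HasDerivAt (fun t : ℝ => (S + t • N)⁻¹) (-(S⁻¹ * N * S⁻¹)) 0 := by
  obtain ⟨u, rfl⟩ := hS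
  have h1 : HasDerivAt (fun t : ℝ => (u : Matrix (Fin k) (Fin k) ℂ) + t • N) N 0 := by
    have := ((hasDerivAt_id (0:ℝ)).smul_const N).const_add (u : Matrix (Fin k) (Fin k) ℂ)
    rw [one_smul] at this
    exact this
  have h2 := hasFDerivAt_ringInverse (𝕜 := ℝ) u
  have h3 : HasFDerivAt Ring.inverse (-ContinuousLinearMap.mulLeftRight ℝ _ (↑u⁻¹ : Matrix (Fin k) (Fin k) ℂ) ↑u⁻¹)
      ((u : Matrix (Fin k) (Fin k) ℂ) + (0:ℝ) • N) := by simpa using h2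
  have h4 := h3.comp_hasDerivAt (0:ℝ) h1
  have h5 : (fun t : ℝ => ((u : Matrix (Fin k) (Fin k) ℂ) + t • N)⁻¹) =
      Ring.inverse ∘ (fun t : ℝ => (u : Matrix (Fin k) (Fin k) ℂ) + t • N) := by
    funext t
    simp [Matrix.nonsing_inv_eq_ringInverse]
  rw [h5]
  refine h4.congr_deriv ?_
  simp [Matrix.coe_units_inv]

theorem aux_retr {k : ℕ} {f : ℝ → Matrix (Fin k) (Fin k) ℂ} {f' : Matrix (Fin k) (Fin k) ℂ}
    {x : ℝ} (h : HasDerivAt f f' x) :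
    HasDerivAt (fun t => (Matrix.trace (f t)).re) (Matrix.trace f').re x := by
  let L : Matrix (Fin k) (Fin k) ℂ →ₗ[ℝ] ℝ := Complex.reLm ∘ₗ (Matrix.traceLinearMap (Fin k) ℝ ℂ)
  exact (LinearMap.toContinuousLinearMap L).hasFDerivAt.comp_hasDerivAt x h

theorem aux_sigma {k : ℕ} (S X Y N : Matrix (Fin k) (Fin k) ℂ) (hS : IsUnit S) :
    HasDerivAt (fun t : ℝ => (Matrix.trace ((S + t • N)⁻¹ * X * (S + t • N)⁻¹ * Y)).re)
      (-(Matrix.trace (S⁻¹ * N * S⁻¹ * X * S⁻¹ * Y)).re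
        - (Matrix.trace (S⁻¹ * X * S⁻¹ * N * S⁻¹ * Y)).re) 0 := by
  have h := aux_inv S N hS
  have := aux_retr (((h.mul_const X).mul h).mul_const Y)
  refine this.congr_deriv ?_
  simp [add_mul, Matrix.mul_assoc, sub_eq_add_neg]

theorem aux_lin {k : ℕ} (S X N : Matrix (Fin k) (Fin k) ℂ) (hS : IsUnit S) :
    HasDerivAt (fun t : ℝ => (Matrix.trace ((S + t • N)⁻¹ * X)).re)
      (-(Matrix.trace (S⁻¹ * X * S⁻¹ * N)).re) 0 := by
  have := aux_retr ((aux_inv S N hS).mul_const X)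
  refine this.congr_deriv ?_
  rw [Matrix.neg_mul, Matrix.trace_neg, Complex.neg_re, Matrix.mul_assoc (S⁻¹ * N),
    Matrix.trace_mul_comm (S⁻¹ * N)]
  simp only [Matrix.mul_assoc]

end helpers

theorem aux_U {p k : ℕ} (U X Y N : Matrix (Fin p) (Fin k) ℂ) :
    HasDerivAt (fun t : ℝ => (Matrix.trace (Xᴴ *
            ((1 : Matrix (Fin p) (Fin p) ℂ) - (1/2 : ℂ) • ((U + t • N) * (U + t • N)ᴴ))
            * Y)).re)
      (-(Matrix.trace (Xᴴ * hermPart (N * Uᴴ) * Y)).re) 0 := by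
  have e : ∀ t : ℝ, (Matrix.trace (Xᴴ *
            ((1 : Matrix (Fin p) (Fin p) ℂ) - (1/2 : ℂ) • ((U + t • N) * (U + t • N)ᴴ))
            * Y)).re = (Matrix.trace (Xᴴ * ((1 : Matrix (Fin p) (Fin p) ℂ)
              - (1/2 : ℂ) • (U * Uᴴ)) * Y)).re
            + t * (-(Matrix.trace (Xᴴ * hermPart (N * Uᴴ) * Y)).re)
            + t ^ 2 * (-(Matrix.trace (Xᴴ * ((1/2 : ℂ) • (N * Nᴴ)) * Y)).re) := by
    intro t
    have : Xᴴ * ((1 : Matrix (Fin p) (Fin p) ℂ)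
          - (1/2 : ℂ) • ((U + t • N) * (U + t • N)ᴴ)) * Y
        = Xᴴ * ((1 : Matrix (Fin p) (Fin p) ℂ) - (1/2 : ℂ) • (U * Uᴴ)) * Y
          + t • (-(Xᴴ * hermPart (N * Uᴴ) * Y))
          + (t ^ 2) • (-(Xᴴ * ((1/2 : ℂ) • (N * Nᴴ)) * Y)) := by
      have h : (1 : Matrix (Fin p) (Fin p) ℂ) - (1/2 : ℂ) • ((U + t • N) * (U + t • N)ᴴ)
          = ((1 : Matrix (Fin p) (Fin p) ℂ) - (1/2 : ℂ) • (U * Uᴴ))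
            + t • (-(hermPart (N * Uᴴ))) + (t ^ 2) • (-((1/2 : ℂ) • (N * Nᴴ))) := by
        simp only [hermPart, Matrix.conjTranspose_add, Matrix.conjTranspose_smul,
          Matrix.conjTranspose_mul, Matrix.conjTranspose_conjTranspose, Matrix.add_mul,
          Matrix.mul_add, Matrix.smul_mul, Matrix.mul_smul, star_trivial]
        module
      rw [h]
      simp only [Matrix.add_mul, Matrix.mul_add, Matrix.smul_mul, Matrix.mul_smul,
        Matrix.neg_mul, Matrix.mul_neg]
    rw [this]
    simp only [Matrix.trace_add, Matrix.trace_smul, Matrix.trace_neg, Complex.add_re,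
      Complex.neg_re, Complex.real_smul, Complex.re_ofReal_mul, Complex.smul_re, smul_eq_mul]
  simp only [e]
  generalize (Matrix.trace (Xᴴ * ((1 : Matrix (Fin p) (Fin p) ℂ)
              - (1/2 : ℂ) • (U * Uᴴ)) * Y)).re = a
  generalize -(Matrix.trace (Xᴴ * hermPart (N * Uᴴ) * Y)).re = b
  generalize -(Matrix.trace (Xᴴ * ((1/2 : ℂ) • (N * Nᴴ)) * Y)).re = c
  have h := (((hasDerivAt_id (0:ℝ)).mul_const b).const_add a).add
    (((hasDerivAt_id (0:ℝ)).pow 2).mul_const c)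
  refine h.congr_deriv ?_
  simp

theorem aux_cyc {k : ℕ} (S X Y N : Matrix (Fin k) (Fin k) ℂ) (hS : S.IsHermitian)
    (hX : X.IsHermitian) (hY : Y.IsHermitian) (hN : N.IsHermitian) :
    (Matrix.trace (S * X * S * N * S * Y)).re = (Matrix.trace (S * X * S * Y * S * N)).re := by
  have h : (Matrix.trace (S * X * S * N * S * Y)ᴴ).re
      = (Matrix.trace (S * X * S * N * S * Y)).re := by
    rw [Matrix.trace_conjTranspose]; simp
  rw [← h]
  simp only [Matrix.conjTranspose_mul, hS.eq, hX.eq, hY.eq, hN.eq]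
  rw [show Y * (S * (N * (S * (X * S)))) = (Y * S * N) * (S * X * S) by
    simp only [Matrix.mul_assoc], Matrix.trace_mul_comm]
  simp only [Matrix.mul_assoc]

/-- Derivative of the Riemannian metric with respect to the base point:
with `ξ, η` fixed and the base point moving along `(U + tνU, Σ + tνΣ)`, the metric
`⟨ξ,η⟩_{(U+tνU, Σ+tνΣ)}` is differentiable at `t = 0` with derivative
`− Re tr(ξUᴴ herm(νU Uᴴ) ηU) − 2α Re tr(Σ⁻¹ξΣΣ⁻¹ηΣΣ⁻¹νΣ)
 − β[Re tr(Σ⁻¹ξΣΣ⁻¹νΣ)·Re tr(Σ⁻¹ηΣ) + Re tr(Σ⁻¹ξΣ)·Re tr(Σ⁻¹ηΣΣ⁻¹νΣ)]`.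
Here `Sig` plays the role of `Σ`. -/
theorem metric_derivative_base_point (p k : ℕ) (hk : 1 ≤ k) (hpk : k ≤ p)
    (U : Matrix (Fin p) (Fin k) ℂ)
    (Sig : Matrix (Fin k) (Fin k) ℂ) (hSig : Sig.PosDef)
    (α β : ℝ)
    (ξU ηU νU : Matrix (Fin p) (Fin k) ℂ)
    (ξS ηS νS : Matrix (Fin k) (Fin k) ℂ)
    (hξS : ξS.IsHermitian) (hηS : ηS.IsHermitian) (hνS : νS.IsHermitian) :
    HasDerivAt
      (fun t : ℝ =>
        (Matrix.trace (ξUᴴ *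
            ((1 : Matrix (Fin p) (Fin p) ℂ) - (1/2 : ℂ) • ((U + t • νU) * (U + t • νU)ᴴ))
            * ηU)).re
          + α * (Matrix.trace ((Sig + t • νS)⁻¹ * ξS * (Sig + t • νS)⁻¹ * ηS)).re
          + β * ((Matrix.trace ((Sig + t • νS)⁻¹ * ξS)).re
              * (Matrix.trace ((Sig + t • νS)⁻¹ * ηS)).re))
      (-(Matrix.trace (ξUᴴ * hermPart (νU * Uᴴ) * ηU)).re
        - 2 * α * (Matrix.trace (Sig⁻¹ * ξS * Sig⁻¹ * ηS * Sig⁻¹ * νS)).re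
        - β * ((Matrix.trace (Sig⁻¹ * ξS * Sig⁻¹ * νS)).re * (Matrix.trace (Sig⁻¹ * ηS)).re
            + (Matrix.trace (Sig⁻¹ * ξS)).re * (Matrix.trace (Sig⁻¹ * ηS * Sig⁻¹ * νS)).re))
      0 := by
  have hu : IsUnit Sig := hSig.isUnit
  have h1 := aux_U U ξU ηU νU
  have h2 := aux_sigma Sig ξS ηS νS hu
  have h3 := aux_lin Sig ξS νS hu
  have h4 := aux_lin Sig ηS νS hu
  have c1 := aux_cyc Sig⁻¹ ξS ηS νS hSig.isHermitian.inv hξS hηS hνS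
  have c2 : Matrix.trace (Sig⁻¹ * νS * Sig⁻¹ * ξS * Sig⁻¹ * ηS)
      = Matrix.trace (Sig⁻¹ * ξS * Sig⁻¹ * ηS * Sig⁻¹ * νS) := by
    rw [show Sig⁻¹ * νS * Sig⁻¹ * ξS * Sig⁻¹ * ηS
      = (Sig⁻¹ * νS) * (Sig⁻¹ * ξS * Sig⁻¹ * ηS) by simp only [Matrix.mul_assoc],
      Matrix.trace_mul_comm]
    simp only [Matrix.mul_assoc]
  rw [c1, c2] at h2
  have h := (h1.add (h2.const_mul α)).add ((h3.mul h4).const_mul β)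
  refine h.congr_deriv ?_
  simp only [zero_smul, add_zero]
  ring
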